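/- Let p > 3 be a prime. Then for all integers m ≥ 0 and r ≥ 1, the central binomial coefficients satisfy C(2m·p^r, m·p^r) ≡ C(2m·p^(r−1), m·p^(r−1)) (mod p^(3r)). -/

import Mathlib

open Finset

/-- The indices below `N` that are prime to `p`. -/
def primeToBelow (p N : ℕ) : Finset ℕ := {k ∈ range N | ¬ p ∣ k}

theorem descFactorial_mul_mul {p : ℕ} (hp : 0 < p) (M n : ℕ) :
    (p * M).descFactorial (p * n) =
      p ^ n * M.descFactorial n * ∏ k ∈ primeToBelow p (p * n), (p * M - k) := by
  rw [Nat.descFactorial_eq_prod_range, Nat.descFactorial_eq_prod_range,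
    ← prod_filter_mul_prod_filter_not (range (p * n)) (fun k => p ∣ k), primeToBelow]
  congr 1
  have himage : {k ∈ range (p * n) | p ∣ k} = (range n).image (p * ·) := by
    ext k
    simp only [mem_filter, mem_range, mem_image]
    constructor
    · rintro ⟨hk, j, rfl⟩
      exact ⟨j, Nat.lt_of_mul_lt_mul_left hk, rfl⟩
    · rintro ⟨j, hj, rfl⟩
      exact ⟨Nat.mul_lt_mul_of_pos_left hj hp, dvd_mul_right _ _⟩
  rw [himage, prod_image fun a _ b _ h => Nat.eq_of_mul_eq_mul_left hp h]
  simp [← Nat.mul_sub, prod_mul_distrib]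

theorem choose_mul_mul_prod {p : ℕ} (hp : 0 < p) (M n : ℕ) :
    (p * M).choose (p * n) * ∏ k ∈ primeToBelow p (p * n), (p * n - k) =
      M.choose n * ∏ k ∈ primeToBelow p (p * n), (p * M - k) := by
  have h := descFactorial_mul_mul hp M n
  have h' := descFactorial_mul_mul hp n n
  rw [Nat.descFactorial_self, Nat.descFactorial_self] at h'
  rw [Nat.descFactorial_eq_factorial_mul_choose, Nat.descFactorial_eq_factorial_mul_choose,
    h'] at h
  have hpos : 0 < p ^ n * n.factorial := by positivity
  apply Nat.eq_of_mul_eq_mul_left hpos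
  linarith

theorem prod_primeToBelow_reflect {α : Type*} [CommMonoid α] {p N : ℕ} (hN : p ∣ N)
    (f : ℕ → α) :
    ∏ k ∈ primeToBelow p N, f (N - k) = ∏ k ∈ primeToBelow p N, f k := by
  have hmem : ∀ k ∈ primeToBelow p N, N - k ∈ primeToBelow p N := by
    intro k hk
    simp only [primeToBelow, mem_filter, mem_range] at hk ⊢
    have hk0 : k ≠ 0 := by
      rintro rfl
      simp at hk
    exact ⟨by omega, fun h => hk.2 ((Nat.dvd_sub_iff_right hk.1.le hN).1 h)⟩
  have hinv : ∀ k ∈ primeToBelow p N, N - (N - k) = k := by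
    intro k hk
    simp only [primeToBelow, mem_filter, mem_range] at hk
    omega
  exact prod_nbij' (N - ·) (N - ·) hmem hmem hinv hinv fun _ _ => rfl

theorem sq_dvd_prod_one_add_sub {R ι : Type*} [CommRing R] (s : Finset ι) (t : R) (c : ι → R) :
    t ^ 2 ∣ ∏ k ∈ s, (1 + t * c k) - (1 + t * ∑ k ∈ s, c k) := by
  classical
  induction s using Finset.induction_on with
  | empty => simp
  | insert a s ha ih =>
    obtain ⟨d, hd⟩ := ih
    rw [prod_insert ha, sum_insert ha, eq_add_of_sub_eq hd]
    exact ⟨d + t * c a * d + c a * ∑ k ∈ s, c k, by ring⟩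

theorem sum_range_mul_natCast {M : Type*} [AddCommMonoid M] (n : ℕ) [NeZero n] (m : ℕ)
    (f : ZMod n → M) : ∑ k ∈ range (m * n), f k = m • ∑ x, f x := by
  have hrange : ∑ k ∈ range n, f k = ∑ x, f x :=
    sum_nbij' (fun k => (k : ZMod n)) ZMod.val (by simp) (by simp [ZMod.val_lt])
      (fun k hk => ZMod.val_cast_of_lt (mem_range.1 hk)) (by simp) (by simp)
  induction m with
  | zero => simp
  | succ m ih =>
    rw [add_mul, one_mul, sum_range_add, ih, succ_nsmul, ← hrange]
    simp

theorem sum_sq_ringInverse_eq_zero {R : Type*} [CommRing R] [Fintype R]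
    (h2 : IsUnit (2 : R)) (h3 : IsUnit (3 : R)) : ∑ x : R, Ring.inverse x ^ 2 = 0 := by
  have hdouble : ∑ x : R, Ring.inverse (2 * x) ^ 2 = ∑ x : R, Ring.inverse x ^ 2 :=
    Equiv.sum_comp h2.unit.mulLeft fun x => Ring.inverse x ^ 2
  have hfactor : ∑ x : R, Ring.inverse (2 * x) ^ 2 =
      Ring.inverse 2 ^ 2 * ∑ x : R, Ring.inverse x ^ 2 := by
    rw [mul_sum]
    refine sum_congr rfl fun x _ => ?_
    rw [Ring.mul_inverse_rev]
    ring
  rw [hdouble] at hfactor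
  have hinv : (2 : R) * Ring.inverse 2 = 1 := Ring.mul_inverse_cancel _ h2
  apply h3.mul_right_eq_zero.1
  linear_combination 4 * hfactor + (2 * Ring.inverse 2 + 1) * (∑ x : R, Ring.inverse x ^ 2) * hinv

theorem isUnit_natCast_zmod_prime_pow {p r : ℕ} (hp : p.Prime) (hr : r ≠ 0) (k : ℕ) :
    IsUnit (k : ZMod (p ^ r)) ↔ ¬ p ∣ k := by
  rw [ZMod.isUnit_iff_coprime, Nat.coprime_pow_right_iff (Nat.pos_of_ne_zero hr),
    Nat.coprime_comm, hp.coprime_iff_not_dvd]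

theorem sum_primeToBelow_sq_ringInverse {p r : ℕ} (hp : p.Prime) (hp3 : 3 < p) (hr : r ≠ 0)
    (m : ℕ) :
    ∑ k ∈ primeToBelow p (m * p ^ r), Ring.inverse (k : ZMod (p ^ r)) ^ 2 = 0 := by
  have : NeZero (p ^ r) := ⟨pow_ne_zero _ hp.ne_zero⟩
  have hunit {k : ℕ} (hk0 : 0 < k) (hk : k < p) : IsUnit (k : ZMod (p ^ r)) :=
    (isUnit_natCast_zmod_prime_pow hp hr k).2 (Nat.not_dvd_of_pos_of_lt hk0 hk)
  rw [primeToBelow, sum_filter_of_ne,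
    sum_range_mul_natCast (p ^ r) m fun x => Ring.inverse x ^ 2,
    sum_sq_ringInverse_eq_zero, smul_zero]
  · exact_mod_cast hunit two_pos (by omega)
  · exact_mod_cast hunit three_pos hp3
  · intro k _ hne
    rw [← isUnit_natCast_zmod_prime_pow hp hr]
    by_contra hk
    simp [Ring.inverse_non_unit _ hk] at hne

theorem prod_add_sq_modEq {p r : ℕ} (hp : p.Prime) (hp3 : 3 < p) (hr : r ≠ 0) (m : ℕ) :
    ∏ k ∈ primeToBelow p (m * p ^ r),
        (2 * ((m * p ^ r : ℕ) : ℤ) ^ 2 + k * ((m * p ^ r : ℕ) - k)) ≡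
      ∏ k ∈ primeToBelow p (m * p ^ r), ((k : ℤ) * ((m * p ^ r : ℕ) - k))
      [ZMOD (p ^ (3 * r) : ℕ)] := by
  have : NeZero (p ^ r) := ⟨pow_ne_zero _ hp.ne_zero⟩
  set N := m * p ^ r with hN
  let t : ℤ := 2 * (N : ℤ) ^ 2
  let c (k : ℕ) : ℤ := -((Ring.inverse (k : ZMod (p ^ r))).val : ℤ) ^ 2
  have hN0 : ((N : ℕ) : ZMod (p ^ r)) = 0 := by
    rw [ZMod.natCast_eq_zero_iff]
    exact dvd_mul_left _ _
  have hpt : (p : ℤ) ^ (2 * r) ∣ t := ⟨2 * m ^ 2, by simp only [t, hN]; push_cast; ring⟩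
  have hpow : ((p ^ (3 * r) : ℕ) : ℤ) = (p : ℤ) ^ (2 * r) * (p ^ r : ℕ) := by
    push_cast
    ring
  have hfactor : ∀ k ∈ primeToBelow p N,
      t + k * ((N : ℤ) - k) ≡ k * ((N : ℤ) - k) * (1 + t * c k) [ZMOD (p ^ (3 * r) : ℕ)] := by
    intro k hk
    have hu : IsUnit (k : ZMod (p ^ r)) :=
      (isUnit_natCast_zmod_prime_pow hp hr k).2 (mem_filter.1 hk).2
    have hinv := Ring.mul_inverse_cancel _ hu
    have hdvd : ((p ^ r : ℕ) : ℤ) ∣ k * ((N : ℤ) - k) * c k - 1 := by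
      rw [← ZMod.intCast_zmod_eq_zero_iff_dvd]
      simp only [c]
      push_cast
      rw [ZMod.natCast_zmod_val, hN0]
      linear_combination ((k : ZMod (p ^ r)) * Ring.inverse (k : ZMod (p ^ r)) + 1) * hinv
    rw [Int.modEq_iff_dvd]
    rw [hpow, show k * ((N : ℤ) - k) * (1 + t * c k) - (t + k * ((N : ℤ) - k)) =
      t * (k * ((N : ℤ) - k) * c k - 1) by ring]
    exact mul_dvd_mul hpt hdvd
  have hsum : ((p ^ r : ℕ) : ℤ) ∣ ∑ k ∈ primeToBelow p N, c k := by
    rw [← ZMod.intCast_zmod_eq_zero_iff_dvd]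
    simp only [c]
    push_cast
    simp only [ZMod.natCast_zmod_val, sum_neg_distrib]
    rw [hN, sum_primeToBelow_sq_ringInverse hp hp3 hr, neg_zero]
  have hone : ∏ k ∈ primeToBelow p N, (1 + t * c k) ≡ 1 [ZMOD (p ^ (3 * r) : ℕ)] := by
    have hsq : ((p ^ (3 * r) : ℕ) : ℤ) ∣ t ^ 2 := by
      push_cast
      refine dvd_trans (pow_dvd_pow _ (by omega : 3 * r ≤ 2 * r * 2)) ?_
      rw [pow_mul]
      exact pow_dvd_pow_of_dvd hpt 2
    have hlin : ((p ^ (3 * r) : ℕ) : ℤ) ∣ t * ∑ k ∈ primeToBelow p N, c k := by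
      rw [hpow]
      exact mul_dvd_mul hpt hsum
    refine (Int.modEq_iff_dvd.2 ?_).symm
    have hdvd := dvd_add (hsq.trans (sq_dvd_prod_one_add_sub (primeToBelow p N) t c)) hlin
    rwa [← sub_sub, sub_add_cancel] at hdvd
  calc _ ≡ ∏ k ∈ primeToBelow p N, (k * ((N : ℤ) - k) * (1 + t * c k))
        [ZMOD (p ^ (3 * r) : ℕ)] := Int.ModEq.prod hfactor
    _ ≡ _ [ZMOD (p ^ (3 * r) : ℕ)] := by
        rw [prod_mul_distrib]
        simpa using hone.mul_left (∏ k ∈ primeToBelow p N, ((k : ℤ) * ((N : ℤ) - k)))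

theorem isCoprime_prod_primeToBelow {p : ℕ} (hp : p.Prime) (N : ℕ) :
    IsCoprime (p : ℤ) (∏ k ∈ primeToBelow p N, (k : ℤ)) := by
  refine IsCoprime.prod_right fun k hk => ?_
  exact Nat.isCoprime_iff_coprime.2 ((hp.coprime_iff_not_dvd).2 (mem_filter.1 hk).2)

theorem prod_add_modEq_prod {p r : ℕ} (hp : p.Prime) (hp3 : 3 < p) (hr : r ≠ 0) (m : ℕ) :
    ∏ k ∈ primeToBelow p (m * p ^ r), (((m * p ^ r : ℕ) : ℤ) + k) ≡
      ∏ k ∈ primeToBelow p (m * p ^ r), (k : ℤ) [ZMOD (p ^ (3 * r) : ℕ)] := by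
  have hsq := prod_add_sq_modEq hp hp3 hr m
  have hpN : p ∣ m * p ^ r := dvd_mul_of_dvd_right (dvd_pow_self p hr) m
  set N := m * p ^ r
  set A := ∏ k ∈ primeToBelow p N, ((N : ℤ) + k) with hA
  set B := ∏ k ∈ primeToBelow p N, (k : ℤ) with hB
  have hcast : ∀ k ∈ primeToBelow p N, ((N - k : ℕ) : ℤ) = N - k := fun k hk =>
    Nat.cast_sub (mem_range.1 (mem_filter.1 hk).1).le
  have hB' : ∏ k ∈ primeToBelow p N, ((N : ℤ) - k) = B := by
    rw [hB, ← prod_primeToBelow_reflect hpN fun k => (k : ℤ)]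
    exact prod_congr rfl fun k hk => (hcast k hk).symm
  have hA' : ∏ k ∈ primeToBelow p N, ((N : ℤ) + (N - k)) = A := by
    rw [hA, ← prod_primeToBelow_reflect hpN fun k => (N : ℤ) + k]
    exact prod_congr rfl fun k hk => by rw [hcast k hk]
  have hAA : ∏ k ∈ primeToBelow p N, (2 * (N : ℤ) ^ 2 + k * (N - k)) = A * A := by
    nth_rewrite 2 [← hA']
    rw [hA, ← prod_mul_distrib]
    exact prod_congr rfl fun k _ => by ring
  have hBB : ∏ k ∈ primeToBelow p N, ((k : ℤ) * (N - k)) = B * B := by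
    rw [prod_mul_distrib, hB']
  rw [hAA, hBB] at hsq
  have hAB : B ≡ A [ZMOD p] := by
    refine Int.ModEq.prod fun k _ => Int.modEq_iff_dvd.2 ?_
    simpa using Int.natCast_dvd_natCast.2 hpN
  have hp2 : IsCoprime (p : ℤ) 2 := by
    have : IsCoprime (p : ℤ) ((2 : ℕ) : ℤ) :=
      Nat.isCoprime_iff_coprime.2 ((Nat.coprime_primes hp Nat.prime_two).2 (by omega))
    simpa using this
  have hcop : IsCoprime (p : ℤ) (A + B) := by
    obtain ⟨d, hd⟩ := Int.modEq_iff_dvd.1 hAB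
    have hsum : A + B = 2 * B + p * d := by linarith
    rw [hsum]
    exact (hp2.mul_right (isCoprime_prod_primeToBelow hp N)).add_mul_left_right d
  refine (Int.modEq_iff_dvd.2 ?_).symm
  have hdvd := hsq.symm.dvd
  push_cast at hdvd ⊢
  refine (hcop.pow_left (m := 3 * r)).dvd_of_dvd_mul_right ?_
  rwa [show (A - B) * (A + B) = A * A - B * B by ring]


/-- `C(2 m p^r, m p^r) ≡ C(2 m p^{r-1}, m p^{r-1}) (mod p^{3r})`. -/
theorem central_binom_supercongruence (p : ℕ) (hp : p.Prime) (hp3 : 3 < p)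
    (m r : ℕ) (hr : 1 ≤ r) :
    (2 * m * p ^ r).choose (m * p ^ r) ≡
      (2 * m * p ^ (r - 1)).choose (m * p ^ (r - 1)) [MOD p ^ (3 * r)] := by
  obtain ⟨s, rfl⟩ : ∃ s, r = s + 1 := ⟨r - 1, by omega⟩
  rw [Nat.add_sub_cancel]
  have hN : m * p ^ (s + 1) = p * (m * p ^ s) := by ring
  have h2N : 2 * m * p ^ (s + 1) = p * (2 * m * p ^ s) := by ring
  have hpN : p ∣ m * p ^ (s + 1) := hN ▸ dvd_mul_right _ _
  have hchoose := choose_mul_mul_prod hp.pos (2 * m * p ^ s) (m * p ^ s)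
  rw [← hN, ← h2N] at hchoose
  have hAB := prod_add_modEq_prod hp hp3 s.succ_ne_zero m
  have hB := isCoprime_prod_primeToBelow hp (m * p ^ (s + 1))
  have hshift : ∏ k ∈ primeToBelow p (m * p ^ (s + 1)), (2 * m * p ^ (s + 1) - k) =
      ∏ k ∈ primeToBelow p (m * p ^ (s + 1)), (m * p ^ (s + 1) + k) := by
    rw [← prod_primeToBelow_reflect hpN]
    refine prod_congr rfl fun k hk => ?_
    have := mem_range.1 (mem_filter.1 hk).1
    rw [mul_assoc]
    omega
  rw [prod_primeToBelow_reflect hpN fun k => k, hshift] at hchoose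
  have hAB' : ∏ k ∈ primeToBelow p (m * p ^ (s + 1)), (m * p ^ (s + 1) + k) ≡
      ∏ k ∈ primeToBelow p (m * p ^ (s + 1)), k [MOD p ^ (3 * (s + 1))] := by
    rw [← Int.natCast_modEq_iff]
    push_cast at hAB ⊢
    exact hAB
  have hcop : Nat.Coprime (p ^ (3 * (s + 1))) (∏ k ∈ primeToBelow p (m * p ^ (s + 1)), k) := by
    refine Nat.Coprime.pow_left _ (Nat.isCoprime_iff_coprime.1 ?_)
    push_cast
    exact hB
  refine Nat.ModEq.cancel_right_of_coprime hcop ?_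
  rw [hchoose]
  exact hAB'.mul_left _
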